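/- Let 1 < p < ∞, let W be a matrix weight on ℝ^d with reducing operators V_I, let I ∈ 𝒟, let λ₁ > 1, and let 𝒢(I) be the collection of maximal dyadic subcubes J of I with ‖V_J V_I^{−1}‖^p > λ₁. Then ∑_{J ∈ 𝒢(I)} |J| ≤ (C₁/λ₁) |I|, where C₁ depends only on n and d. -/

import Mathlib

open MeasureTheory ENNReal
open scoped ComplexOrder

noncomputable section

/-! ## Basic linear-algebra notation -/

/-- The operator norm of an `n × n` complex matrix, viewed as an operator on the
Euclidean space `ℂⁿ`. -/
def matNorm {n : ℕ} (M : Matrix (Fin n) (Fin n) ℂ) : ℝ :=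
  ‖Matrix.toEuclideanCLM (𝕜 := ℂ) (n := Fin n) M‖

/-- A matrix applied to a vector of `ℂⁿ` (with its Euclidean norm). -/
def mApp {n : ℕ} (M : Matrix (Fin n) (Fin n) ℂ) (v : EuclideanSpace ℂ (Fin n)) :
    EuclideanSpace ℂ (Fin n) :=
  Matrix.toEuclideanCLM (𝕜 := ℂ) (n := Fin n) M v


/-- Entrywise measurability of a matrix-valued function. -/
def MatMeasurable {d n : ℕ} (W : (Fin d → ℝ) → Matrix (Fin n) (Fin n) ℂ) : Prop :=
  ∀ i j, Measurable fun x => W x i j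

/-! ## Dyadic cubes and Haar functions -/

/-- A dyadic cube in `ℝ^d`, with side length `2^k` and lower-left corner `(m i * 2^k)_i`. -/
structure DCube (d : ℕ) where
  k : ℤ
  m : Fin d → ℤ

namespace DCube

variable {d : ℕ}

/-- The (half-open) cube in `ℝ^d` determined by a dyadic cube. -/
def set (I : DCube d) : Set (Fin d → ℝ) :=
  {x | ∀ i, (I.m i : ℝ) * 2 ^ I.k ≤ x i ∧ x i < ((I.m i : ℝ) + 1) * 2 ^ I.k}

/-- The volume `|I| = (2^k)^d` of a dyadic cube. -/
def vol (I : DCube d) : ℝ := ((2 : ℝ) ^ I.k) ^ d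

/-- The lower-left corner of a dyadic cube. -/
def corner (I : DCube d) : Fin d → ℝ := fun i => (I.m i : ℝ) * 2 ^ I.k

/-- The side length of a dyadic cube. -/
def side (I : DCube d) : ℝ := (2 : ℝ) ^ I.k

end DCube

/-- One-dimensional Haar functions on the dyadic interval `[m·2^k, (m+1)·2^k)`:
`haar1D true` is the non-cancellative `|I|^{-1/2} χ_I`, while `haar1D false` is
`|I|^{-1/2} (χ_{I_ℓ} - χ_{I_r})`. -/
def haar1D (ε : Bool) (k mm : ℤ) (t : ℝ) : ℝ :=
  if ε then
    Set.indicator {s : ℝ | (mm : ℝ) * 2 ^ k ≤ s ∧ s < ((mm : ℝ) + 1) * 2 ^ k}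
      (fun _ => ((2 : ℝ) ^ k) ^ (-(1 / 2 : ℝ))) t
  else
    Set.indicator {s : ℝ | (mm : ℝ) * 2 ^ k ≤ s ∧ s < (mm : ℝ) * 2 ^ k + 2 ^ (k - 1)}
      (fun _ => ((2 : ℝ) ^ k) ^ (-(1 / 2 : ℝ))) t -
    Set.indicator {s : ℝ | (mm : ℝ) * 2 ^ k + 2 ^ (k - 1) ≤ s ∧ s < ((mm : ℝ) + 1) * 2 ^ k}
      (fun _ => ((2 : ℝ) ^ k) ^ (-(1 / 2 : ℝ))) t

/-- The signature set `𝒮 = {0,1}^d \ {(1,…,1)}` indexing the cancellative Haar functions. -/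
def Sfin (d : ℕ) : Finset (Fin d → Bool) := Finset.univ.erase (fun _ => true)

/-- The Haar function `h_I^ε = ∏ i, h_{I_i}^{ε_i}` associated to a dyadic cube `I ⊂ ℝ^d`
and a signature `ε ∈ {0,1}^d`. -/
def haarFn {d : ℕ} (I : DCube d) (ε : Fin d → Bool) (x : Fin d → ℝ) : ℝ :=
  ∏ i, haar1D (ε i) I.k (I.m i) (x i)

/-- The (vector of) Haar coefficients `f_I^ε = ∫ f h_I^ε` of a `ℂⁿ`-valued function. -/
def haarCoef {d n : ℕ} (f : (Fin d → ℝ) → EuclideanSpace ℂ (Fin n)) (I : DCube d)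
    (ε : Fin d → Bool) : EuclideanSpace ℂ (Fin n) :=
  ∫ x, haarFn I ε x • f x

/-! ## Matrix `A_p` weights and reducing operators -/

/-- The (closed, axis-parallel) cube with corner `c` and side length `r`. -/
def cubeSet {d : ℕ} (c : Fin d → ℝ) (r : ℝ) : Set (Fin d → ℝ) :=
  {x | ∀ i, c i ≤ x i ∧ x i ≤ c i + r}

/-- The matrix `A_p` characteristic `‖W‖_{A_p}` of a matrix weight `W`, expressed in terms of
`W1p = W^{1/p}` (so that `W^{-1/p} = (W1p)⁻¹`):
`sup_I (1/|I|) ∫_I ((1/|I|) ∫_I ‖W^{1/p}(x) W^{-1/p}(t)‖^{p'} dt)^{p/p'} dx`,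
the supremum being over all cubes `I ⊂ ℝ^d`.  Here `p' = p/(p-1)` and `p/p' = p - 1`. -/
def apNorm {d n : ℕ} (p : ℝ) (W1p : (Fin d → ℝ) → Matrix (Fin n) (Fin n) ℂ) : ℝ≥0∞ :=
  ⨆ (c : Fin d → ℝ) (r : ℝ) (_ : 0 < r),
    (ENNReal.ofReal (r ^ d))⁻¹ *
      ∫⁻ x in cubeSet c r,
        ((ENNReal.ofReal (r ^ d))⁻¹ *
            ∫⁻ t in cubeSet c r,
              ENNReal.ofReal (matNorm (W1p x * (W1p t)⁻¹)) ^ (p / (p - 1))) ^ (p - 1)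

/-- The `L^q` average `(|I|^{-1} ∫_I ‖A(x) e‖^q dx)^{1/q}` over a dyadic cube. -/
def redAvgD {d n : ℕ} (q : ℝ) (A : (Fin d → ℝ) → Matrix (Fin n) (Fin n) ℂ) (I : DCube d)
    (e : EuclideanSpace ℂ (Fin n)) : ℝ≥0∞ :=
  ((ENNReal.ofReal I.vol)⁻¹ * ∫⁻ x in I.set, ENNReal.ofReal ‖mApp (A x) e‖ ^ q) ^ (1 / q)

/-- `V` is a family of reducing operators for the weight `W = (W1p)^p` (indexed by dyadic
cubes), with comparability constants `c₁, c₂`:  each `V I` is positive definite and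
`|V_I e| ≈ (|I|^{-1} ∫_I |W^{1/p}(x) e|^p dx)^{1/p}`. -/
def IsReducing {d n : ℕ} (p c₁ c₂ : ℝ) (W1p : (Fin d → ℝ) → Matrix (Fin n) (Fin n) ℂ)
    (V : DCube d → Matrix (Fin n) (Fin n) ℂ) : Prop :=
  ∀ I : DCube d, (V I).PosDef ∧ ∀ e : EuclideanSpace ℂ (Fin n),
    ENNReal.ofReal c₁ * redAvgD p W1p I e ≤ ENNReal.ofReal ‖mApp (V I) e‖ ∧
    ENNReal.ofReal ‖mApp (V I) e‖ ≤ ENNReal.ofReal c₂ * redAvgD p W1p I e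

/-- `V'` is a family of dual reducing operators for the weight `W = (W1p)^p`:
`|V_I' e| ≈ (|I|^{-1} ∫_I |W^{-1/p}(x) e|^{p'} dx)^{1/p'}` with `p' = p/(p-1)`. -/
def IsDualReducing {d n : ℕ} (p c₁ c₂ : ℝ) (W1p : (Fin d → ℝ) → Matrix (Fin n) (Fin n) ℂ)
    (V' : DCube d → Matrix (Fin n) (Fin n) ℂ) : Prop :=
  ∀ I : DCube d, (V' I).PosDef ∧ ∀ e : EuclideanSpace ℂ (Fin n),
    ENNReal.ofReal c₁ * redAvgD (p / (p - 1)) (fun x => (W1p x)⁻¹) I e ≤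
        ENNReal.ofReal ‖mApp (V' I) e‖ ∧
    ENNReal.ofReal ‖mApp (V' I) e‖ ≤
        ENNReal.ofReal c₂ * redAvgD (p / (p - 1)) (fun x => (W1p x)⁻¹) I e

/-- The `L^p(W)` norm `(∫ |W^{1/p}(x) f(x)|^p dx)^{1/p}` (as a value in `[0,∞]`). -/
def wNorm {d n : ℕ} (p : ℝ) (W1p : (Fin d → ℝ) → Matrix (Fin n) (Fin n) ℂ)
    (f : (Fin d → ℝ) → EuclideanSpace ℂ (Fin n)) : ℝ≥0∞ :=
  (∫⁻ x, ENNReal.ofReal ‖mApp (W1p x) (f x)‖ ^ p) ^ (1 / p)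

/-- The square-function expression
`∑_{I ∈ 𝒟} ∑_{ε ∈ 𝒮} |A_I f_I^ε|² |I|^{-1} χ_I(x)` for a family of matrices `A_I`. -/
def sqFn {d n : ℕ} (A : DCube d → Matrix (Fin n) (Fin n) ℂ)
    (f : (Fin d → ℝ) → EuclideanSpace ℂ (Fin n)) (x : Fin d → ℝ) : ℝ≥0∞ :=
  ∑' I : DCube d, ∑ ε ∈ Sfin d,
    Set.indicator I.set
      (fun _ => ENNReal.ofReal (‖mApp (A I) (haarCoef f I ε)‖ ^ 2) / ENNReal.ofReal I.vol) x

/-! ## Stopping times -/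

/-- A stopping time assigns to each dyadic cube `I` a collection `𝒥 I` of pairwise disjoint
dyadic subcubes of `I`. -/
def IsStopping {d : ℕ} (𝒥 : DCube d → Set (DCube d)) : Prop :=
  ∀ I : DCube d, (∀ J ∈ 𝒥 I, J.set ⊆ I.set) ∧
    (𝒥 I).Pairwise fun J K => Disjoint J.set K.set

/-- `ℱ(I)`: the dyadic subcubes of `I` not contained in any stopping cube `J ∈ 𝒥(I)`. -/
def Fcol {d : ℕ} (𝒥 : DCube d → Set (DCube d)) (I : DCube d) : Set (DCube d) :=
  {J | J.set ⊆ I.set ∧ ∀ K ∈ 𝒥 I, ¬J.set ⊆ K.set}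

/-- A stopping time is admissible if `I ∈ ℱ(I)` for every `I`. -/
def Admissible {d : ℕ} (𝒥 : DCube d → Set (DCube d)) : Prop :=
  ∀ I : DCube d, I ∈ Fcol 𝒥 I

/-- The iterated stopping collections: `𝒥^0(I) = {I}` and
`𝒥^{j+1}(I) = ⋃_{J ∈ 𝒥^j(I)} 𝒥(J)`. -/
def JIter {d : ℕ} (𝒥 : DCube d → Set (DCube d)) : ℕ → DCube d → Set (DCube d)
  | 0, I => {I}
  | j + 1, I => ⋃ J ∈ JIter 𝒥 j I, 𝒥 J

/-- A stopping time is decaying with constant `c` if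
`∑_{J ∈ 𝒥(I)} |J| ≤ c |I|` for every `I`. -/
def Decaying {d : ℕ} (c : ℝ) (𝒥 : DCube d → Set (DCube d)) : Prop :=
  ∀ I : DCube d,
    ∑' J : 𝒥 I, ENNReal.ofReal (J : DCube d).vol ≤ ENNReal.ofReal c * ENNReal.ofReal I.vol

/-- `ℱ^j = ℱ^j(I₀) = ⋃_{J ∈ 𝒥^{j-1}(I₀)} ℱ(J)` (intended for `j ≥ 1`). -/
def Fj {d : ℕ} (𝒥 : DCube d → Set (DCube d)) (I₀ : DCube d) (j : ℕ) : Set (DCube d) :=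
  ⋃ J ∈ JIter 𝒥 (j - 1) I₀, Fcol 𝒥 J

/-- The Haar projection `Δ_j f = ∑_{I ∈ ℱ^j} ∑_{ε ∈ 𝒮} f_I^ε h_I^ε`. -/
def deltaHaar {d n : ℕ} (𝒥 : DCube d → Set (DCube d)) (I₀ : DCube d) (j : ℕ)
    (f : (Fin d → ℝ) → EuclideanSpace ℂ (Fin n)) (x : Fin d → ℝ) :
    EuclideanSpace ℂ (Fin n) :=
  ∑' I : Fj 𝒥 I₀ j, ∑ ε ∈ Sfin d, haarFn (I : DCube d) ε x • haarCoef f (I : DCube d) ε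

/-! ## Constant Haar multipliers -/

/-- `∑_{I ∈ S} ∑_{ε ∈ 𝒮} V_I^{-1} f_I^ε h_I^ε(x)`. -/
def projInv {d n : ℕ} (V : DCube d → Matrix (Fin n) (Fin n) ℂ) (S : Set (DCube d))
    (f : (Fin d → ℝ) → EuclideanSpace ℂ (Fin n)) (x : Fin d → ℝ) :
    EuclideanSpace ℂ (Fin n) :=
  ∑' I : S, ∑ ε ∈ Sfin d,
    haarFn (I : DCube d) ε x • mApp ((V (I : DCube d))⁻¹) (haarCoef f (I : DCube d) ε)

/-- A function has finite Haar expansion if it is a finite sum of Haar functions. -/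
def FiniteHaar {d n : ℕ} (f : (Fin d → ℝ) → EuclideanSpace ℂ (Fin n)) : Prop :=
  ∃ F : Finset (DCube d × (Fin d → Bool)),
    ∀ x, f x = ∑ q ∈ F, haarFn q.1 q.2 x • haarCoef f q.1 q.2

/-! ## The weighted stopping time -/

/-- The stopping condition `‖V_J V_I^{-1}‖^p > λ₁` or `‖V_J^{-1} V_I‖^{p'} > λ₂`. -/
def stopBad {d n : ℕ} (p l₁ l₂ : ℝ) (V : DCube d → Matrix (Fin n) (Fin n) ℂ)
    (J I : DCube d) : Prop :=
  l₁ < matNorm (V J * (V I)⁻¹) ^ p ∨ l₂ < matNorm ((V J)⁻¹ * V I) ^ (p / (p - 1))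

/-- The stopping time `𝒥(I)` = maximal dyadic subcubes `J ⊆ I` satisfying `stopBad`. -/
def stopST {d n : ℕ} (p l₁ l₂ : ℝ) (V : DCube d → Matrix (Fin n) (Fin n) ℂ)
    (I : DCube d) : Set (DCube d) :=
  {J | J.set ⊆ I.set ∧ stopBad p l₁ l₂ V J I ∧
    ∀ K : DCube d, K.set ⊆ I.set → stopBad p l₁ l₂ V K I → J.set ⊆ K.set → K = J}


namespace DCube

variable {d : ℕ}

instance : Countable (DCube d) := by
  have h : Function.Injective (fun J : DCube d => (J.k, J.m)) := by
    rintro ⟨k, m⟩ ⟨k', m'⟩ h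
    simpa using h
  exact h.countable

lemma vol_pos (J : DCube d) : 0 < J.vol := by
  unfold vol; positivity

lemma measurableSet_set (J : DCube d) : MeasurableSet J.set := by
  have h : J.set = Set.pi Set.univ
      fun i => Set.Ico ((J.m i : ℝ) * 2 ^ J.k) (((J.m i : ℝ) + 1) * 2 ^ J.k) := by
    ext x; simp [set]
  rw [h]
  exact MeasurableSet.univ_pi fun _ => measurableSet_Ico

lemma set_subset_of_mem_of_le {J K : DCube d} {x : Fin d → ℝ} (hJ : x ∈ J.set) (hK : x ∈ K.set)
    (hk : J.k ≤ K.k) : J.set ⊆ K.set := by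
  obtain ⟨t, ht⟩ := Int.le.dest hk
  have h2 : (2 : ℝ) ^ K.k = 2 ^ t * 2 ^ J.k := by
    rw [← ht, zpow_add₀ two_ne_zero, zpow_natCast, mul_comm]
  have hpos : (0 : ℝ) < 2 ^ J.k := by positivity
  intro y hy i
  obtain ⟨a1, a2⟩ := hJ i
  obtain ⟨b1, b2⟩ := hK i
  obtain ⟨y1, y2⟩ := hy i
  rw [h2, ← mul_assoc] at b1 b2 ⊢
  have l1 : K.m i * 2 ^ t ≤ J.m i := by
    have := lt_of_mul_lt_mul_right (b1.trans_lt a2) hpos.le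
    exact Int.lt_add_one_iff.mp (by exact_mod_cast this)
  have l2 : J.m i + 1 ≤ (K.m i + 1) * 2 ^ t := by
    have := lt_of_mul_lt_mul_right (a1.trans_lt b2) hpos.le
    exact Int.add_one_le_iff.mpr (by exact_mod_cast this)
  have l1' : (K.m i : ℝ) * 2 ^ t ≤ J.m i := by exact_mod_cast l1
  have l2' : (J.m i : ℝ) + 1 ≤ ((K.m i : ℝ) + 1) * 2 ^ t := by exact_mod_cast l2
  rw [← mul_assoc]
  exact ⟨(mul_le_mul_of_nonneg_right l1' hpos.le).trans y1,
    y2.trans_le (mul_le_mul_of_nonneg_right l2' hpos.le)⟩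

lemma subset_or_subset_or_disjoint (J K : DCube d) :
    J.set ⊆ K.set ∨ K.set ⊆ J.set ∨ Disjoint J.set K.set := by
  by_cases h : Disjoint J.set K.set
  · exact .inr (.inr h)
  · obtain ⟨x, hJ, hK⟩ := Set.not_disjoint_iff.mp h
    rcases le_total J.k K.k with hk | hk
    · exact .inl (set_subset_of_mem_of_le hJ hK hk)
    · exact .inr (.inl (set_subset_of_mem_of_le hK hJ hk))

end DCube

lemma mApp_mul {n : ℕ} (A B : Matrix (Fin n) (Fin n) ℂ) (v : EuclideanSpace ℂ (Fin n)) :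
    mApp (A * B) v = mApp A (mApp B v) := by
  simp [mApp]

lemma matNorm_le_sum {n : ℕ} (M : Matrix (Fin n) (Fin n) ℂ) :
    matNorm M ≤ ∑ i, ‖mApp M (EuclideanSpace.single i 1)‖ := by
  refine ContinuousLinearMap.opNorm_le_bound _ (by positivity) fun v => ?_
  have hv : v = ∑ i, v i • EuclideanSpace.single i (1 : ℂ) := by
    simpa using ((EuclideanSpace.basisFun (Fin n) ℂ).sum_repr v).symm
  conv_lhs => rw [hv]
  rw [map_sum, Finset.sum_mul]
  refine (norm_sum_le _ _).trans (Finset.sum_le_sum fun i _ => ?_)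
  rw [map_smul, norm_smul, mul_comm]
  exact mul_le_mul_of_nonneg_left (PiLp.norm_apply_le v i) (norm_nonneg _)

lemma ofReal_matNorm_rpow_le {n : ℕ} {p : ℝ} (hp : 1 ≤ p) (M : Matrix (Fin n) (Fin n) ℂ) :
    ENNReal.ofReal (matNorm M ^ p) ≤ (n : ℝ≥0∞) ^ (p - 1) *
      ∑ i, ENNReal.ofReal ‖mApp M (EuclideanSpace.single i 1)‖ ^ p := by
  have h0 : 0 ≤ matNorm M := norm_nonneg _
  rw [← ENNReal.ofReal_rpow_of_nonneg h0 (by linarith)]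
  calc ENNReal.ofReal (matNorm M) ^ p
      ≤ (∑ i, ENNReal.ofReal ‖mApp M (EuclideanSpace.single i 1)‖) ^ p := by
        refine ENNReal.rpow_le_rpow ?_ (by linarith)
        rw [← ENNReal.ofReal_sum_of_nonneg fun _ _ => norm_nonneg _]
        exact ENNReal.ofReal_le_ofReal (matNorm_le_sum M)
    _ ≤ _ := by
        simpa using ENNReal.rpow_sum_le_const_mul_sum_rpow Finset.univ
          (fun i => ENNReal.ofReal ‖mApp M (EuclideanSpace.single i 1)‖) hp

/-- The defining property of the reducing average, cleared of the exponent and the volume. -/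
lemma vol_mul_redAvgD_rpow {d n : ℕ} {q : ℝ} (hq : 0 < q)
    (A : (Fin d → ℝ) → Matrix (Fin n) (Fin n) ℂ) (J : DCube d) (e : EuclideanSpace ℂ (Fin n)) :
    ENNReal.ofReal J.vol * redAvgD q A J e ^ q =
      ∫⁻ x in J.set, ENNReal.ofReal ‖mApp (A x) e‖ ^ q := by
  rw [redAvgD, ← ENNReal.rpow_mul, one_div_mul_cancel hq.ne', ENNReal.rpow_one, ← mul_assoc,
    ENNReal.mul_inv_cancel (by simpa using J.vol_pos) ENNReal.ofReal_ne_top, one_mul]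

lemma IsReducing.vol_mul_le {d n : ℕ} {p c₁ c₂ : ℝ} (hp : 0 < p)
    {W1p : (Fin d → ℝ) → Matrix (Fin n) (Fin n) ℂ} {V : DCube d → Matrix (Fin n) (Fin n) ℂ}
    (hV : IsReducing p c₁ c₂ W1p V) (J : DCube d) (e : EuclideanSpace ℂ (Fin n)) :
    ENNReal.ofReal J.vol * ENNReal.ofReal ‖mApp (V J) e‖ ^ p ≤
      ENNReal.ofReal c₂ ^ p * ∫⁻ x in J.set, ENNReal.ofReal ‖mApp (W1p x) e‖ ^ p := by
  rw [← vol_mul_redAvgD_rpow hp, mul_left_comm, ← ENNReal.mul_rpow_of_nonneg _ _ hp.le]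
  gcongr
  exact ((hV J).2 e).2

lemma IsReducing.lintegral_le {d n : ℕ} {p c₁ c₂ : ℝ} (hp : 0 < p)
    {W1p : (Fin d → ℝ) → Matrix (Fin n) (Fin n) ℂ} {V : DCube d → Matrix (Fin n) (Fin n) ℂ}
    (hV : IsReducing p c₁ c₂ W1p V) (I : DCube d) (e : EuclideanSpace ℂ (Fin n)) :
    ENNReal.ofReal c₁ ^ p * ∫⁻ x in I.set, ENNReal.ofReal ‖mApp (W1p x) e‖ ^ p ≤
      ENNReal.ofReal I.vol * ENNReal.ofReal ‖mApp (V I) e‖ ^ p := by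
  rw [← vol_mul_redAvgD_rpow hp, mul_left_comm, ← ENNReal.mul_rpow_of_nonneg _ _ hp.le]
  gcongr
  exact ((hV I).2 e).1

lemma tsum_setLIntegral_le {d : ℕ} {S : Set (DCube d)} {I : DCube d}
    (hI : ∀ J ∈ S, J.set ⊆ I.set) (hS : S.Pairwise fun J K => Disjoint J.set K.set)
    (f : (Fin d → ℝ) → ℝ≥0∞) :
    ∑' J : S, ∫⁻ x in (J : DCube d).set, f x ≤ ∫⁻ x in I.set, f x := by
  rw [← lintegral_iUnion (fun J : S => (J : DCube d).measurableSet_set)]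
  · exact lintegral_mono_set (Set.iUnion_subset fun J => hI J J.2)
  · intro J K hJK
    exact hS J.2 K.2 (Subtype.coe_ne_coe.mpr hJK)

lemma IsReducing.vol_mul_le_sum_lintegral {d n : ℕ} {p c₁ c₂ l : ℝ} (hp : 1 ≤ p)
    {W1p : (Fin d → ℝ) → Matrix (Fin n) (Fin n) ℂ} {V : DCube d → Matrix (Fin n) (Fin n) ℂ}
    (hV : IsReducing p c₁ c₂ W1p V) {J : DCube d} {A : Matrix (Fin n) (Fin n) ℂ}
    (hl : l ≤ matNorm (V J * A) ^ p) :
    ENNReal.ofReal l * ENNReal.ofReal J.vol ≤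
      (n : ℝ≥0∞) ^ (p - 1) * ENNReal.ofReal c₂ ^ p *
        ∑ i, ∫⁻ x in J.set,
          ENNReal.ofReal ‖mApp (W1p x) (mApp A (EuclideanSpace.single i 1))‖ ^ p := by
  calc ENNReal.ofReal l * ENNReal.ofReal J.vol
      ≤ ((n : ℝ≥0∞) ^ (p - 1) *
          ∑ i, ENNReal.ofReal ‖mApp (V J * A) (EuclideanSpace.single i 1)‖ ^ p) *
          ENNReal.ofReal J.vol := by
        gcongr
        exact (ENNReal.ofReal_le_ofReal hl).trans (ofReal_matNorm_rpow_le hp _)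
    _ = (n : ℝ≥0∞) ^ (p - 1) * ∑ i, ENNReal.ofReal J.vol *
          ENNReal.ofReal ‖mApp (V J) (mApp A (EuclideanSpace.single i 1))‖ ^ p := by
        simp only [mApp_mul]
        rw [mul_assoc, mul_comm _ (ENNReal.ofReal J.vol), Finset.mul_sum]
    _ ≤ _ := by
        rw [mul_assoc, Finset.mul_sum _ _ (ENNReal.ofReal c₂ ^ p)]
        exact mul_le_mul_right (Finset.sum_le_sum fun i _ => hV.vol_mul_le (by linarith) J _) _

/-- Let `1 < p < ∞`, let `W` be a matrix weight on `ℝ^d` with reducing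
operators `V_I`, let `I ∈ 𝒟`, let `λ₁ > 1`, and let `𝒢(I)` be the collection of maximal
dyadic subcubes `J ⊆ I` with `‖V_J V_I^{-1}‖^p > λ₁`.  Then
`∑_{J ∈ 𝒢(I)} |J| ≤ (C₁ / λ₁) |I|`, where `C₁` depends only on `n, d` (and `p` and the
comparability constants `c₁, c₂` of the reducing operators). -/
theorem statement6 (d n : ℕ) (hd : 0 < d) (hn : 0 < n) (p c₁ c₂ : ℝ)
    (hp : 1 < p) (hc₁ : 0 < c₁) (hc₂ : 0 < c₂) :
    ∃ C₁ : ℝ, 0 < C₁ ∧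
      ∀ (W1p : (Fin d → ℝ) → Matrix (Fin n) (Fin n) ℂ)
        (V : DCube d → Matrix (Fin n) (Fin n) ℂ) (I : DCube d) (l₁ : ℝ),
        MatMeasurable W1p →
        (∀ᵐ x ∂(volume : Measure (Fin d → ℝ)), (W1p x).PosDef) →
        IsReducing p c₁ c₂ W1p V →
        1 < l₁ →
        ∑' J : {J : DCube d | J.set ⊆ I.set ∧ l₁ < matNorm (V J * (V I)⁻¹) ^ p ∧
              ∀ K : DCube d, K.set ⊆ I.set → l₁ < matNorm (V K * (V I)⁻¹) ^ p →
                J.set ⊆ K.set → K = J},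
            ENNReal.ofReal (J : DCube d).vol ≤
          ENNReal.ofReal (C₁ / l₁) * ENNReal.ofReal I.vol := by
  have hp0 : 0 < p := by linarith
  have hn' : (0 : ℝ) < n := by exact_mod_cast hn
  refine ⟨(n : ℝ) ^ (p - 1) * c₂ ^ p * n / c₁ ^ p, by positivity, ?_⟩
  intro W1p V I l₁ _ _ hV hl
  have hl0 : 0 < l₁ := by linarith
  set S : Set (DCube d) := {J : DCube d | J.set ⊆ I.set ∧ l₁ < matNorm (V J * (V I)⁻¹) ^ p ∧
              ∀ K : DCube d, K.set ⊆ I.set → l₁ < matNorm (V K * (V I)⁻¹) ^ p →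
                J.set ⊆ K.set → K = J}
  have hS : S.Pairwise fun J K => Disjoint J.set K.set := by
    intro J hJ K hK hne
    rcases DCube.subset_or_subset_or_disjoint J K with h | h | h
    · exact absurd (hJ.2.2 K hK.1 hK.2.1 h).symm hne
    · exact absurd (hK.2.2 J hJ.1 hJ.2.1 h) hne
    · exact h
  set f : Fin n → (Fin d → ℝ) → ℝ≥0∞ := fun i x =>
    ENNReal.ofReal ‖mApp (W1p x) (mApp (V I)⁻¹ (EuclideanSpace.single i 1))‖ ^ p with hf
  have hsum : ENNReal.ofReal l₁ * ∑' J : S, ENNReal.ofReal (J : DCube d).vol ≤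
      (n : ℝ≥0∞) ^ (p - 1) * ENNReal.ofReal c₂ ^ p * ∑ i, ∫⁻ x in I.set, f i x := by
    calc ENNReal.ofReal l₁ * ∑' J : S, ENNReal.ofReal (J : DCube d).vol
        ≤ ∑' J : S, (n : ℝ≥0∞) ^ (p - 1) * ENNReal.ofReal c₂ ^ p *
            ∑ i, ∫⁻ x in (J : DCube d).set, f i x := by
          rw [← ENNReal.tsum_mul_left]
          exact ENNReal.tsum_le_tsum fun J => hV.vol_mul_le_sum_lintegral hp.le J.2.2.1.le
      _ = (n : ℝ≥0∞) ^ (p - 1) * ENNReal.ofReal c₂ ^ p *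
            ∑ i, ∑' J : S, ∫⁻ x in (J : DCube d).set, f i x := by
          rw [ENNReal.tsum_mul_left, Summable.tsum_finsetSum fun _ _ => ENNReal.summable]
      _ ≤ _ := by
          gcongr with i
          exact tsum_setLIntegral_le (fun J hJ => hJ.1) hS (f i)
  have hint : ENNReal.ofReal c₁ ^ p * ∑ i, ∫⁻ x in I.set, f i x ≤
      n * ENNReal.ofReal I.vol := by
    rw [Finset.mul_sum]
    refine (Finset.sum_le_card_nsmul _ _ (ENNReal.ofReal I.vol) fun i _ => ?_).trans (by simp)
    refine (hV.lintegral_le hp0 I _).trans_eq ?_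
    have hu : V I * (V I)⁻¹ = 1 :=
      Matrix.mul_nonsing_inv _ ((Matrix.isUnit_iff_isUnit_det _).mp (hV I).1.isUnit)
    rw [← mApp_mul, hu]
    simp [mApp]
  have hc : ENNReal.ofReal (l₁ * c₁ ^ p) = ENNReal.ofReal c₁ ^ p * ENNReal.ofReal l₁ := by
    rw [mul_comm, ENNReal.ofReal_mul (by positivity), ENNReal.ofReal_rpow_of_pos hc₁]
  have hN : ENNReal.ofReal ((n : ℝ) ^ (p - 1) * c₂ ^ p * n) =
      (n : ℝ≥0∞) ^ (p - 1) * ENNReal.ofReal c₂ ^ p * n := by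
    rw [ENNReal.ofReal_mul (by positivity), ENNReal.ofReal_mul (by positivity),
      ← ENNReal.ofReal_rpow_of_pos hn', ← ENNReal.ofReal_rpow_of_pos hc₂, ENNReal.ofReal_natCast]
  rw [div_div, mul_comm (c₁ ^ p), ENNReal.ofReal_div_of_pos (by positivity),
    ← ENNReal.mul_div_right_comm, ENNReal.le_div_iff_mul_le
      (.inl (ENNReal.ofReal_pos.mpr (by positivity)).ne') (.inl ENNReal.ofReal_ne_top),
    mul_comm, hc, hN, mul_assoc, mul_assoc]
  calc _ ≤ ENNReal.ofReal c₁ ^ p *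
        ((n : ℝ≥0∞) ^ (p - 1) * ENNReal.ofReal c₂ ^ p * ∑ i, ∫⁻ x in I.set, f i x) := by gcongr
    _ = (n : ℝ≥0∞) ^ (p - 1) * ENNReal.ofReal c₂ ^ p *
        (ENNReal.ofReal c₁ ^ p * ∑ i, ∫⁻ x in I.set, f i x) := by ring
    _ ≤ _ := by gcongr

end
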